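/- arXiv:2402.13159 — 5 statements merged into one kernel-verified Lean document; each statement's English description precedes it below -/
import Mathlib

section
/- Let s > 0, let a ≤ b be reals, let T ≥ (b − a)/s, and let U ⊆ ℝ be Lebesgue measurable with a ∉ U. Then the infimum, over all s-Lipschitz functions γ : [0,T] → ℝ with γ(0) = a and γ(T) = b, of the Lebesgue measure of {t ∈ [0,T] : γ(t) ∈ U}, equals λ(U ∩ [a,b])/s, and this infimum is attained (e.g. by the traversal that waits at a for time T − (b−a)/s and then moves from a to b at speed exactly s). (This is the exact obstacle-crossing cost used throughout Section 4: an optimal traversal crosses obstacles at maximum speed, and its cost is proportional to the total width of the obstacles between a and b.) -/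
open MeasureTheory Set
open scoped ENNReal

/-- `γ` is an `s`-Lipschitz traversal on the time interval `[0, T]`. -/
def IsSLip (s T : ℝ) (γ : ℝ → ℝ) : Prop :=
  ∀ t ∈ Set.Icc (0:ℝ) T, ∀ t' ∈ Set.Icc (0:ℝ) T, |γ t - γ t'| ≤ s * |t - t'|

/-- Occupation time of `γ` in the set `U` during `[0, T]`. -/
noncomputable def occupation (T : ℝ) (γ : ℝ → ℝ) (U : Set ℝ) : ℝ≥0∞ :=
  volume {t ∈ Set.Icc (0:ℝ) T | γ t ∈ U}

theorem IsSLip.lipschitzOnWith {s T : ℝ} {γ : ℝ → ℝ} (h : IsSLip s T γ) :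
    LipschitzOnWith s.toNNReal γ (Icc 0 T) := by
  refine LipschitzOnWith.of_dist_le_mul fun x hx y hy => ?_
  rw [Real.dist_eq, Real.dist_eq]
  exact (h x hx y hy).trans
    (mul_le_mul_of_nonneg_right (Real.le_coe_toNNReal s) (abs_nonneg _))

theorem LipschitzOnWith.volume_image_le {K : NNReal} {f : ℝ → ℝ} {A : Set ℝ}
    (h : LipschitzOnWith K f A) : volume (f '' A) ≤ K * volume A := by
  simpa [hausdorffMeasure_real] using h.hausdorffMeasure_image_le zero_le_one

theorem IsSLip.volume_div_le_occupation {s T : ℝ} {γ : ℝ → ℝ} (hT : 0 ≤ T)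
    (h : IsSLip s T γ) (U : Set ℝ) :
    volume (U ∩ Icc (γ 0) (γ T)) / ENNReal.ofReal s ≤ occupation T γ U := by
  have hsub : U ∩ Icc (γ 0) (γ T) ⊆ γ '' {t ∈ Icc (0 : ℝ) T | γ t ∈ U} := by
    rintro y ⟨hyU, hy⟩
    obtain ⟨t, ht, rfl⟩ := intermediate_value_Icc hT h.lipschitzOnWith.continuousOn hy
    exact ⟨t, ⟨ht, hyU⟩, rfl⟩
  refine ENNReal.div_le_of_le_mul' ((measure_mono hsub).trans ?_)
  exact (h.lipschitzOnWith.mono (sep_subset _ _)).volume_image_le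

/-- The traversal that waits at `a` and then moves at speed `s` so as to reach `b` at time `T`. -/
noncomputable def waitThenRun (s T a b : ℝ) (t : ℝ) : ℝ := max a (b - s * (T - t))

theorem isSLip_waitThenRun {s : ℝ} (hs : 0 ≤ s) (T a b : ℝ) :
    IsSLip s T (waitThenRun s T a b) := by
  intro t _ t' _
  refine (abs_max_sub_max_le_max _ _ _ _).trans ?_
  rw [sub_self, abs_zero, show b - s * (T - t) - (b - s * (T - t')) = s * (t - t') by ring,
    abs_mul, abs_of_nonneg hs]
  exact max_le (by positivity) le_rfl

theorem occupation_waitThenRun {s T a b : ℝ} (hs : 0 < s) (hT : (b - a) / s ≤ T)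
    {U : Set ℝ} (haU : a ∉ U) :
    occupation T (waitThenRun s T a b) U = volume (U ∩ Icc a b) / ENNReal.ofReal s := by
  rw [div_le_iff₀ hs] at hT
  have hset : {t ∈ Icc (0 : ℝ) T | waitThenRun s T a b t ∈ U} =
      (s * ·) ⁻¹' ((b - s * T + ·) ⁻¹' (U ∩ Icc a b)) := by
    ext t
    have hline : b - s * T + s * t = b - s * (T - t) := by ring
    simp only [mem_ofPred_eq, mem_preimage, hline, waitThenRun]
    constructor
    · rintro ⟨⟨_, htT⟩, hU⟩
      rcases le_total (b - s * (T - t)) a with hle | hle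
      · rw [max_eq_left hle] at hU
        exact absurd hU haU
      · rw [max_eq_right hle] at hU
        exact ⟨hU, hle, by nlinarith⟩
    · rintro ⟨hU, hle, hge⟩
      rw [max_eq_right hle]
      exact ⟨⟨by nlinarith, by nlinarith⟩, hU⟩
  rw [occupation, hset, Real.volume_preimage_mul_left hs.ne', measure_preimage_add,
    abs_of_pos (inv_pos.2 hs), ENNReal.ofReal_inv_of_pos hs, mul_comm, div_eq_mul_inv]

/-- Exact obstacle-crossing cost: for `s > 0`, `a ≤ b`, `T ≥ (b−a)/s` and a measurable
obstacle set `U` with `a ∉ U`, the optimal occupation time of speed-`s` traversals from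
`a` to `b` equals `λ(U ∩ [a,b]) / s`, and this infimum is attained. -/
theorem obstacle_crossing_cost
    (s T a b : ℝ) (hs : 0 < s) (hab : a ≤ b) (hT : (b - a) / s ≤ T)
    (U : Set ℝ) (hU : MeasurableSet U) (haU : a ∉ U) :
    sInf {c : ℝ≥0∞ | ∃ γ : ℝ → ℝ, IsSLip s T γ ∧ γ 0 = a ∧ γ T = b ∧ c = occupation T γ U}
        = volume (U ∩ Set.Icc a b) / ENNReal.ofReal s ∧
    ∃ γ : ℝ → ℝ, IsSLip s T γ ∧ γ 0 = a ∧ γ T = b ∧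
      occupation T γ U = volume (U ∩ Set.Icc a b) / ENNReal.ofReal s := by
  have hT0 : 0 ≤ T := (div_nonneg (sub_nonneg.2 hab) hs.le).trans hT
  have hlip := isSLip_waitThenRun hs.le T a b
  have h0 : waitThenRun s T a b 0 = a := by
    rw [div_le_iff₀ hs] at hT
    exact max_eq_left (by linarith)
  have hend : waitThenRun s T a b T = b := by simp [waitThenRun, hab]
  have hocc := occupation_waitThenRun hs hT haU
  refine ⟨le_antisymm (sInf_le ⟨_, hlip, h0, hend, hocc.symm⟩) (le_sInf ?_),
    _, hlip, h0, hend, hocc⟩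
  rintro _ ⟨γ, hγ, rfl, rfl, rfl⟩
  exact hγ.volume_div_le_occupation hT0 U
end

section
/- Let s ≥ 0, T ≥ 0, let a, b ∈ ℝ with |a − b| ≤ s·T, and let U ⊆ ℝ be open. Then there exists an s-Lipschitz function γ* : [0,T] → ℝ with γ*(0) = a and γ*(T) = b whose occupation time in U equals the infimum, over all s-Lipschitz γ : [0,T] → ℝ with γ(0) = a and γ(T) = b, of the occupation time of γ in U. (Existence of an optimal traversal: this justifies the 'min' rather than 'inf' in the paper's definitions of the slab cost f(λ_{i−1}, λ_i) and of the barking distance, since the obstacle set {y : d(p, Q[y]) > ρ} is defined by a strict inequality and is hence open in the parameter.) -/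
open MeasureTheory Set
open scoped ENNReal

open Filter Topology

/-- Fatou's lemma for sets, without measurability assumptions. -/
theorem measure_le_of_eventually_mem_of_tendsto {α : Type*} [MeasurableSpace α] {μ : Measure α}
    {A : Set α} {S : ℕ → Set α} {m : ℝ≥0∞} (hA : ∀ x ∈ A, ∀ᶠ n in atTop, x ∈ S n)
    (hm : Tendsto (fun n => μ (S n)) atTop (𝓝 m)) : μ A ≤ m := by
  have hmono : Monotone fun N : ℕ => ⋂ n ≥ N, S n := fun N M hNM x hx => by
    simp only [mem_iInter] at hx ⊢
    exact fun n hn => hx n (hNM.trans hn)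
  calc μ A ≤ μ (⋃ N : ℕ, ⋂ n ≥ N, S n) := measure_mono fun x hx => by
        obtain ⟨N, hN⟩ := eventually_atTop.1 (hA x hx)
        exact mem_iUnion.2 ⟨N, mem_iInter₂.2 hN⟩
    _ = ⨆ N : ℕ, μ (⋂ n ≥ N, S n) := hmono.measure_iUnion
    _ ≤ m := iSup_le fun N => ge_of_tendsto hm <| (eventually_ge_atTop N).mono fun n hn =>
        measure_mono (iInter₂_subset n hn)

/-- The occupation time of an open set is lower semicontinuous under pointwise convergence. -/
theorem occupation_le_of_tendsto {T : ℝ} {γ : ℝ → ℝ} {δ : ℕ → ℝ → ℝ} {U : Set ℝ} {m : ℝ≥0∞}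
    (hU : IsOpen U) (hδ : ∀ t ∈ Icc 0 T, Tendsto (fun n => δ n t) atTop (𝓝 (γ t)))
    (hm : Tendsto (fun n => occupation T (δ n) U) atTop (𝓝 m)) : occupation T γ U ≤ m := by
  refine measure_le_of_eventually_mem_of_tendsto (fun t ht => ?_) hm
  filter_upwards [(hδ t ht.1).eventually_mem (hU.mem_nhds ht.2)] with n hn using ⟨ht.1, hn⟩

theorem IsSLip.of_tendsto {s T : ℝ} {γ : ℝ → ℝ} {δ : ℕ → ℝ → ℝ} (h : ∀ n, IsSLip s T (δ n))
    (hδ : ∀ t ∈ Icc 0 T, Tendsto (fun n => δ n t) atTop (𝓝 (γ t))) : IsSLip s T γ :=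
  fun t ht t' ht' => le_of_tendsto ((hδ t ht).sub (hδ t' ht')).abs
    (Eventually.of_forall fun n => h n t ht t' ht')

theorem IsSLip.continuous_restrict {s T : ℝ} {γ : ℝ → ℝ} (h : IsSLip s T γ) :
    Continuous fun t : Icc 0 T => γ t :=
  have : LipschitzWith s.toNNReal fun t : Icc 0 T => γ t :=
    .of_dist_le' fun x y => h x x.2 y y.2
  this.continuous

/-- Arzelà–Ascoli for traversals with a common starting point. -/
theorem IsSLip.exists_subseq_tendsto {s T a : ℝ} (hs : 0 ≤ s) (hT : 0 ≤ T) {δ : ℕ → ℝ → ℝ}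
    (h : ∀ n, IsSLip s T (δ n)) (ha : ∀ n, δ n 0 = a) :
    ∃ (γ : ℝ → ℝ) (φ : ℕ → ℕ), StrictMono φ ∧
      ∀ t ∈ Icc 0 T, Tendsto (fun n => δ (φ n) t) atTop (𝓝 (γ t)) := by
  let F : ℕ → BoundedContinuousFunction (Icc 0 T) ℝ := fun n =>
    BoundedContinuousFunction.mkOfCompact ⟨fun t => δ n t, (h n).continuous_restrict⟩
  have hF : IsCompact (closure (range F)) := by
    refine BoundedContinuousFunction.arzela_ascoli (Metric.closedBall a (s * T))
      (isCompact_closedBall a _) _ ?_ ?_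
    · rintro _ t ⟨n, rfl⟩
      have h0 := h n t t.2 0 ⟨le_rfl, hT⟩
      rw [ha, sub_zero, abs_of_nonneg t.2.1] at h0
      exact h0.trans (mul_le_mul_of_nonneg_left t.2.2 hs)
    · refine Metric.equicontinuous_of_continuity_modulus (fun r => s * r) ?_ _ ?_
      · exact Continuous.tendsto' (by fun_prop) _ _ (mul_zero s)
      · rintro x y ⟨_, n, rfl⟩
        exact h n x x.2 y y.2
  obtain ⟨f, -, φ, hφ, hf⟩ := hF.tendsto_subseq fun n => subset_closure (mem_range_self n)
  refine ⟨IccExtend hT f, φ, hφ, fun t ht => ?_⟩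
  rw [IccExtend_of_mem hT f ht]
  exact ((continuous_eval_const (⟨t, ht⟩ : Icc 0 T)).tendsto f).comp hf

theorem exists_isSLip {s T a b : ℝ} (hs : 0 ≤ s) (hT : 0 ≤ T) (hab : |a - b| ≤ s * T) :
    ∃ γ : ℝ → ℝ, IsSLip s T γ ∧ γ 0 = a ∧ γ T = b := by
  rcases hT.eq_or_lt with rfl | hT
  · obtain rfl : a = b := by simpa [sub_eq_zero] using hab
    exact ⟨fun _ => a, fun t _ t' _ => by simpa using mul_nonneg hs (abs_nonneg _), rfl, rfl⟩
  · refine ⟨fun t => a + (b - a) / T * t, fun t _ t' _ => ?_, by simp, by field_simp; ring⟩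
    rw [show a + (b - a) / T * t - (a + (b - a) / T * t') = (b - a) / T * (t - t') by ring, abs_mul]
    gcongr
    rwa [abs_div, abs_of_pos hT, div_le_iff₀ hT, abs_sub_comm]

/-- Existence of an optimal speed-bounded traversal: for an open obstacle set `U`,
some `s`-Lipschitz traversal from `a` to `b` attains the infimum of the occupation
time in `U`. -/
theorem exists_optimal_traversal
    (s T a b : ℝ) (hs : 0 ≤ s) (hT : 0 ≤ T) (hab : |a - b| ≤ s * T)
    (U : Set ℝ) (hU : IsOpen U) :
    ∃ γ : ℝ → ℝ, IsSLip s T γ ∧ γ 0 = a ∧ γ T = b ∧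
      occupation T γ U =
        sInf {c : ℝ≥0∞ | ∃ δ : ℝ → ℝ, IsSLip s T δ ∧ δ 0 = a ∧ δ T = b ∧
          c = occupation T δ U} := by
  set C : Set ℝ≥0∞ := {c | ∃ δ : ℝ → ℝ, IsSLip s T δ ∧ δ 0 = a ∧ δ T = b ∧
    c = occupation T δ U}
  have hC : C.Nonempty := by
    obtain ⟨γ, hγ, h0, h1⟩ := exists_isSLip hs hT hab
    exact ⟨_, γ, hγ, h0, h1, rfl⟩
  obtain ⟨c, -, hc, hcC⟩ := exists_seq_tendsto_sInf hC (OrderBot.bddBelow C)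
  choose δ hδ h0 h1 hcδ using hcC
  obtain ⟨γ, φ, hφ, hγ⟩ := IsSLip.exists_subseq_tendsto hs hT hδ h0
  have hlip : IsSLip s T γ := .of_tendsto (fun n => hδ (φ n)) hγ
  have hγ0 : γ 0 = a :=
    tendsto_nhds_unique (hγ 0 ⟨le_rfl, hT⟩) (by simp only [h0, tendsto_const_nhds])
  have hγT : γ T = b :=
    tendsto_nhds_unique (hγ T ⟨hT, le_rfl⟩) (by simp only [h1, tendsto_const_nhds])
  refine ⟨γ, hlip, hγ0, hγT, le_antisymm ?_ (sInf_le ⟨γ, hlip, hγ0, hγT, rfl⟩)⟩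
  refine occupation_le_of_tendsto hU hγ ?_
  simpa only [Function.comp_def, hcδ] using hc.comp hφ.tendsto_atTop
end

section
/- Let s ≥ 0, T ≥ 0, let B ⊆ [0,T] × ℝ be Borel, and for an s-Lipschitz γ : [0,T] → ℝ write C(γ) = λ({t ∈ [0,T] : (t, γ(t)) ∈ B}). Let γ₁, γ₂ : [0,T] → ℝ be s-Lipschitz with γ₁(0) ≥ γ₂(0) and γ₁(T) ≤ γ₂(T). Then there exists t* ∈ [0,T] with γ₁(t*) = γ₂(t*); moreover, defining σ₁ to agree with γ₂ on [0,t*] and with γ₁ on [t*,T], and σ₂ to agree with γ₁ on [0,t*] and with γ₂ on [t*,T], both σ₁ and σ₂ are s-Lipschitz, satisfy σ₁(0) = γ₂(0), σ₁(T) = γ₁(T), σ₂(0) = γ₁(0), σ₂(T) = γ₂(T), and C(σ₁) + C(σ₂) = C(γ₁) + C(γ₂). (Path-splicing/exchange lemma: two crossing speed-bounded traversals can be spliced at a crossing point without changing the total cost; this is the core of the paper's proof that the optimal-start function Ψ(λ_i) is monotone.) -/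
open MeasureTheory Set
open scoped ENNReal

/-- Cost of a traversal `γ`: the time its graph spends in the obstacle set `B`. -/
noncomputable def graphCost (T : ℝ) (B : Set (ℝ × ℝ)) (γ : ℝ → ℝ) : ℝ≥0∞ :=
  volume {t ∈ Set.Icc (0:ℝ) T | (t, γ t) ∈ B}

theorem IsSLip.continuousOn {s T : ℝ} {γ : ℝ → ℝ} (hs : 0 ≤ s) (h : IsSLip s T γ) :
    ContinuousOn γ (Set.Icc (0:ℝ) T) := by
  have hL : LipschitzOnWith ⟨s, hs⟩ γ (Set.Icc (0:ℝ) T) :=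
    LipschitzOnWith.of_dist_le_mul fun x hx y hy => by
      rw [Real.dist_eq, Real.dist_eq]
      exact h x hx y hy
  exact hL.continuousOn

/-- Two `s`-Lipschitz traversals that meet at time `c` can be concatenated there. -/
theorem IsSLip.splice {s T c : ℝ} {f g : ℝ → ℝ} (hf : IsSLip s T f) (hg : IsSLip s T g)
    (hc : c ∈ Set.Icc (0:ℝ) T) (hfg : f c = g c) :
    IsSLip s T (fun t => if t ≤ c then f t else g t) := by
  have across : ∀ a ∈ Set.Icc (0:ℝ) T, ∀ b ∈ Set.Icc (0:ℝ) T, a ≤ c → c ≤ b →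
      |f a - g b| ≤ s * |a - b| := by
    intro a ha b hb hac hcb
    have h1 := hf a ha c hc
    have h2 := hg c hc b hb
    rw [abs_of_nonpos (sub_nonpos.2 hac)] at h1
    rw [abs_of_nonpos (sub_nonpos.2 hcb)] at h2
    rw [abs_of_nonpos (sub_nonpos.2 (hac.trans hcb))]
    have h3 := abs_sub_le (f a) (f c) (g b)
    rw [hfg] at h1 h3
    linarith
  intro t ht t' ht'
  dsimp only
  split_ifs with h h' h'
  · exact hf t ht t' ht'
  · exact across t ht t' ht' h (not_le.1 h').le
  · rw [abs_sub_comm, abs_sub_comm t t']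
    exact across t' ht' t ht h' (not_le.1 h).le
  · exact hg t ht t' ht'

/-- The cost of a concatenation is the sum of the costs of its two parts. -/
theorem graphCost_splice (T c : ℝ) (B : Set (ℝ × ℝ)) (f g : ℝ → ℝ) :
    graphCost T B (fun t => if t ≤ c then f t else g t) =
      volume ({t ∈ Set.Icc (0:ℝ) T | (t, f t) ∈ B} ∩ Set.Iic c) +
        volume ({t ∈ Set.Icc (0:ℝ) T | (t, g t) ∈ B} \ Set.Iic c) := by
  rw [graphCost, ← measure_inter_add_sdiff _ (measurableSet_Iic (a := c))]
  congr 2 <;> ext t <;> by_cases h : t ≤ c <;> simp [h]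

/-- Path-splicing/exchange lemma: two crossing speed-bounded traversals can be
spliced at a crossing point `t*` without changing the total cost. -/
theorem splice_exchange
    (s T : ℝ) (hs : 0 ≤ s) (hT : 0 ≤ T)
    (B : Set (ℝ × ℝ)) (hB : MeasurableSet B)
    (hBsub : B ⊆ Set.Icc (0:ℝ) T ×ˢ (Set.univ : Set ℝ))
    (γ₁ γ₂ : ℝ → ℝ) (h₁ : IsSLip s T γ₁) (h₂ : IsSLip s T γ₂)
    (h0 : γ₂ 0 ≤ γ₁ 0) (hTend : γ₁ T ≤ γ₂ T) :
    ∃ tstar ∈ Set.Icc (0:ℝ) T, γ₁ tstar = γ₂ tstar ∧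
      IsSLip s T (fun t => if t ≤ tstar then γ₂ t else γ₁ t) ∧
      IsSLip s T (fun t => if t ≤ tstar then γ₁ t else γ₂ t) ∧
      (fun t => if t ≤ tstar then γ₂ t else γ₁ t) 0 = γ₂ 0 ∧
      (fun t => if t ≤ tstar then γ₂ t else γ₁ t) T = γ₁ T ∧
      (fun t => if t ≤ tstar then γ₁ t else γ₂ t) 0 = γ₁ 0 ∧
      (fun t => if t ≤ tstar then γ₁ t else γ₂ t) T = γ₂ T ∧
      graphCost T B (fun t => if t ≤ tstar then γ₂ t else γ₁ t)
          + graphCost T B (fun t => if t ≤ tstar then γ₁ t else γ₂ t)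
        = graphCost T B γ₁ + graphCost T B γ₂ := by
  obtain ⟨c, hc, hcross⟩ : ∃ c ∈ Set.Icc (0:ℝ) T, γ₁ c = γ₂ c := by
    obtain ⟨c, hc, h⟩ := intermediate_value_Icc' hT
      ((h₁.continuousOn hs).sub (h₂.continuousOn hs))
      (show (0:ℝ) ∈ Set.Icc (γ₁ T - γ₂ T) (γ₁ 0 - γ₂ 0) from
        ⟨sub_nonpos.2 hTend, sub_nonneg.2 h0⟩)
    exact ⟨c, hc, sub_eq_zero.1 h⟩
  have endpoint : ∀ f g : ℝ → ℝ, f c = g c → (if T ≤ c then f T else g T) = g T := by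
    intro f g hfg
    split_ifs with h
    · rw [le_antisymm h hc.2, hfg]
    · rfl
  refine ⟨c, hc, hcross, h₂.splice h₁ hc hcross.symm, h₁.splice h₂ hc hcross,
    if_pos hc.1, endpoint γ₂ γ₁ hcross.symm, if_pos hc.1, endpoint γ₁ γ₂ hcross, ?_⟩
  rw [graphCost_splice, graphCost_splice, graphCost, graphCost,
    ← measure_inter_add_sdiff {t ∈ Set.Icc (0:ℝ) T | (t, γ₁ t) ∈ B} (measurableSet_Iic (a := c)),
    ← measure_inter_add_sdiff {t ∈ Set.Icc (0:ℝ) T | (t, γ₂ t) ∈ B} (measurableSet_Iic (a := c))]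
  ring
end

section
/- Let d ≥ 1, let a₀, a₁, c₀, c₁ ∈ ℝ^d, and let ρ ≥ 0. Then the set {(u, v) ∈ [0,1] × [0,1] : ‖((1−u)·a₀ + u·a₁) − ((1−v)·c₀ + v·c₁)‖ ≤ ρ} is convex. (The free-space cell of a pair of segments: for each segment P_i of P and each segment Q_j of Q, the clear space of the Barkable Space Diagram within the corresponding rectangular cell is the intersection of the cell with a convex region — a 'cut ellipse' C_{i,j}; this convexity is the basis of the continuous-setting algorithm in Section 5.) -/
open Set

/-- Convexity of the free-space cell for a pair of segments: the set of parameter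
pairs `(u,v) ∈ [0,1] × [0,1]` where the corresponding points of the segments
`a₀a₁` and `c₀c₁` are within barking radius `ρ` of each other is convex (the
'cut ellipse' of the Barkable Space Diagram). -/
theorem free_space_cell_convex
    (d : ℕ) (hd : 1 ≤ d) (a₀ a₁ c₀ c₁ : EuclideanSpace ℝ (Fin d)) (ρ : ℝ) (hρ : 0 ≤ ρ) :
    Convex ℝ {uv : ℝ × ℝ | uv.1 ∈ Set.Icc (0:ℝ) 1 ∧ uv.2 ∈ Set.Icc (0:ℝ) 1 ∧
      ‖((1 - uv.1) • a₀ + uv.1 • a₁) - ((1 - uv.2) • c₀ + uv.2 • c₁)‖ ≤ ρ} := by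
  have hball := (convex_closedBall (0 : EuclideanSpace ℝ (Fin d)) ρ).affine_preimage
    ((AffineMap.lineMap a₀ a₁).comp (LinearMap.fst ℝ ℝ ℝ).toAffineMap -
      (AffineMap.lineMap c₀ c₁).comp (LinearMap.snd ℝ ℝ ℝ).toAffineMap)
  have hcell : Convex ℝ (Icc (0 : ℝ) 1 ×ˢ Icc (0 : ℝ) 1) :=
    (convex_Icc 0 1).prod (convex_Icc 0 1)
  convert hcell.inter hball using 1
  ext uv
  simp [AffineMap.lineMap_apply_module, and_assoc, -Icc_prod_Icc]
end

section
/- Let s ≥ 0, let U ⊆ ℝ² be Borel, let 0 = x₀ < x₁ < ⋯ < x_n = S be a partition of [0,S], and let a, b ∈ ℝ. For 1 ≤ i ≤ n and u, v ∈ ℝ define f_i(u, v) ∈ [0, ∞] as the infimum, over all s-Lipschitz functions γ : [x_{i−1}, x_i] → ℝ with γ(x_{i−1}) = u and γ(x_i) = v, of λ({t ∈ [x_{i−1}, x_i] : (t, γ(t)) ∈ U}) (with infimum over the empty set equal to +∞). Then the infimum, over all s-Lipschitz γ : [0,S] → ℝ with γ(0) = a and γ(S) = b, of λ({t ∈ [0,S]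 : (t, γ(t)) ∈ U}), equals the infimum over all tuples (λ₀, λ₁, …, λ_n) ∈ ℝ^{n+1} with λ₀ = a and λ_n = b of the sum Σ_{i=1}^{n} f_i(λ_{i−1}, λ_i). (Dynamic-programming/concatenation principle across the vertical slabs of the Barkable Space Diagram: this justifies the paper's recursion F_i(λ_i) = min_{λ_{i−1}} ( F_{i−1}(λ_{i−1}) + f(λ_{i−1}, λ_i) ) and the fact that the barking distance equals F_n(|Q|).) -/
open MeasureTheory Set
open scoped ENNReal

/-- `γ` is an `s`-Lipschitz traversal on the time interval `[α, β]`. -/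
def IsSLipOn (s α β : ℝ) (γ : ℝ → ℝ) : Prop :=
  ∀ t ∈ Set.Icc α β, ∀ t' ∈ Set.Icc α β, |γ t - γ t'| ≤ s * |t - t'|

/-- The slab cost: the infimum, over `s`-Lipschitz traversals `γ : [α, β] → ℝ` with
`γ α = u` and `γ β = v`, of the time the graph of `γ` spends in the obstacle set `U`
(the infimum over the empty set being `∞`). -/
noncomputable def slabCost (s : ℝ) (U : Set (ℝ × ℝ)) (α β u v : ℝ) : ℝ≥0∞ :=
  sInf {c : ℝ≥0∞ | ∃ γ : ℝ → ℝ, IsSLipOn s α β γ ∧ γ α = u ∧ γ β = v ∧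
    c = volume {t ∈ Set.Icc α β | (t, γ t) ∈ U}}

theorem IsSLipOn.mono {s α β α' β' : ℝ} {γ : ℝ → ℝ} (h : IsSLipOn s α β γ)
    (hα : α ≤ α') (hβ : β' ≤ β) : IsSLipOn s α' β' γ :=
  fun t ht t' ht' => h t (Icc_subset_Icc hα hβ ht) t' (Icc_subset_Icc hα hβ ht')

theorem IsSLipOn.congr {s α β : ℝ} {γ γ' : ℝ → ℝ} (h : IsSLipOn s α β γ)
    (heq : EqOn γ' γ (Icc α β)) : IsSLipOn s α β γ' := fun t ht t' ht' => by
  rw [heq ht, heq ht']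
  exact h t ht t' ht'

theorem IsSLipOn.of_adjacent {s α β δ : ℝ} {γ : ℝ → ℝ}
    (h₁ : IsSLipOn s α β γ) (h₂ : IsSLipOn s β δ γ) : IsSLipOn s α δ γ := by
  have cross : ∀ t ∈ Icc α β, ∀ t' ∈ Icc β δ, |γ t - γ t'| ≤ s * |t - t'| := by
    intro t ht t' ht'
    calc |γ t - γ t'| ≤ |γ t - γ β| + |γ β - γ t'| := abs_sub_le _ _ _
      _ ≤ s * |t - β| + s * |β - t'| :=
        add_le_add (h₁ t ht β ⟨ht.1.trans ht.2, le_rfl⟩) (h₂ β ⟨le_rfl, ht'.1.trans ht'.2⟩ t' ht')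
      _ = s * |t - t'| := by
        rw [abs_of_nonpos (sub_nonpos.2 ht.2), abs_of_nonpos (sub_nonpos.2 ht'.1),
          abs_of_nonpos (sub_nonpos.2 (ht.2.trans ht'.1))]
        ring
  intro t ht t' ht'
  rcases le_total t β with h | h <;> rcases le_total t' β with h' | h'
  · exact h₁ t ⟨ht.1, h⟩ t' ⟨ht'.1, h'⟩
  · exact cross t ⟨ht.1, h⟩ t' ⟨h', ht'.2⟩
  · rw [abs_sub_comm, abs_sub_comm t]
    exact cross t' ⟨ht'.1, h'⟩ t ⟨h, ht.2⟩
  · exact h₂ t ⟨h, ht.2⟩ t' ⟨h', ht'.2⟩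

theorem volume_sep_Icc_add_sep_Icc {α β δ : ℝ} (hαβ : α ≤ β) (hβδ : β ≤ δ) (p : ℝ → Prop) :
    volume {t ∈ Icc α β | p t} + volume {t ∈ Icc β δ | p t} = volume {t ∈ Icc α δ | p t} := by
  rw [← measure_inter_add_sdiff {t ∈ Icc α δ | p t} (measurableSet_Iic (a := β))]
  congr 1
  · congr 1
    ext t
    simp only [mem_inter_iff, mem_ofPred_eq, mem_Icc, mem_Iic]
    grind
  · rw [← measure_sdiff_null (s := {t ∈ Icc β δ | p t}) (measure_singleton β)]
    congr 1
    ext t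
    simp only [mem_sdiff, mem_ofPred_eq, mem_Icc, mem_Iic, mem_singleton_iff]
    grind

theorem sum_volume_sep_Icc {x : ℕ → ℝ} {n : ℕ} (hx : ∀ i, i < n → x i ≤ x (i + 1))
    (p : ℝ → Prop) :
    x 0 ≤ x n ∧ ∑ i ∈ Finset.range n, volume {t ∈ Icc (x i) (x (i + 1)) | p t} =
      volume {t ∈ Icc (x 0) (x n) | p t} := by
  induction n with
  | zero =>
    refine ⟨le_rfl, ?_⟩
    rw [Finset.sum_range_zero, Icc_self]
    exact (measure_mono_null (sep_subset _ _) (measure_singleton _)).symm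
  | succ n ih =>
    obtain ⟨hle, hsum⟩ := ih fun i hi => hx i (hi.trans n.lt_succ_self)
    have hn := hx n n.lt_succ_self
    exact ⟨hle.trans hn, by rw [Finset.sum_range_succ, hsum, volume_sep_Icc_add_sep_Icc hle hn]⟩

theorem slabCost_le {s α β : ℝ} {γ : ℝ → ℝ} (h : IsSLipOn s α β γ) (U : Set (ℝ × ℝ)) :
    slabCost s U α β (γ α) (γ β) ≤ volume {t ∈ Icc α β | (t, γ t) ∈ U} :=
  sInf_le ⟨γ, h, rfl, rfl, rfl⟩

theorem slabCost_self (s : ℝ) (U : Set (ℝ × ℝ)) (α u : ℝ) : slabCost s U α α u u = 0 := by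
  refine le_antisymm ((slabCost_le (s := s) (γ := fun _ => u) ?_ U).trans_eq ?_) zero_le
  · intro t ht t' ht'
    rw [Icc_self, mem_singleton_iff] at ht ht'
    simp [ht, ht']
  · rw [Icc_self]
    exact measure_mono_null (sep_subset _ _) (measure_singleton _)

theorem slabCost_le_add {s α β δ : ℝ} (hαβ : α ≤ β) (hβδ : β ≤ δ) (U : Set (ℝ × ℝ))
    (u v w : ℝ) : slabCost s U α δ u w ≤ slabCost s U α β u v + slabCost s U β δ v w := by
  conv_rhs => rw [slabCost, ENNReal.sInf_add]
  refine le_iInf₂ ?_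
  rintro _ ⟨γ₁, h₁, rfl, hv, rfl⟩
  rw [slabCost.eq_def s U β, add_comm, ENNReal.sInf_add]
  refine le_iInf₂ ?_
  rintro _ ⟨γ₂, h₂, hv', rfl, rfl⟩
  set γ : ℝ → ℝ := fun t => if t ≤ β then γ₁ t else γ₂ t
  have e₁ : EqOn γ γ₁ (Icc α β) := fun t ht => if_pos ht.2
  have e₂ : EqOn γ γ₂ (Icc β δ) := by
    intro t ht
    rcases ht.1.eq_or_lt with rfl | hlt
    · exact (if_pos le_rfl).trans (hv.trans hv'.symm)
    · exact if_neg hlt.not_ge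
  have hγ := (h₁.congr e₁).of_adjacent (h₂.congr e₂)
  have hcost := slabCost_le hγ U
  rw [e₁ ⟨le_rfl, hαβ⟩, e₂ ⟨hβδ, le_rfl⟩, ← volume_sep_Icc_add_sep_Icc hαβ hβδ, add_comm] at hcost
  refine hcost.trans (add_le_add (measure_mono ?_) (measure_mono ?_)) <;> rintro t ⟨ht, htU⟩
  · exact ⟨ht, by rwa [e₂ ht] at htU⟩
  · exact ⟨ht, by rwa [e₁ ht] at htU⟩

theorem slabCost_le_sum (s : ℝ) (U : Set (ℝ × ℝ)) {x : ℕ → ℝ} {n : ℕ}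
    (hx : ∀ i, i < n → x i ≤ x (i + 1)) (lam : ℕ → ℝ) :
    slabCost s U (x 0) (x n) (lam 0) (lam n) ≤
      ∑ i ∈ Finset.range n, slabCost s U (x i) (x (i + 1)) (lam i) (lam (i + 1)) := by
  induction n with
  | zero => simp [slabCost_self]
  | succ n ih =>
    have hx' : ∀ i, i < n → x i ≤ x (i + 1) := fun i hi => hx i (hi.trans n.lt_succ_self)
    rw [Finset.sum_range_succ]
    exact (slabCost_le_add (sum_volume_sep_Icc hx' fun _ => True).1 (hx n n.lt_succ_self) U _
      (lam n) _).trans (add_le_add_left (ih hx') _)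

/-- Dynamic-programming/concatenation principle across the vertical slabs of the
Barkable Space Diagram: the optimal occupation time over `[0,S]` equals the infimum,
over all choices of intermediate values `λ₀ = a, λ₁, …, λₙ = b` at the partition
points, of the sum of the slab costs. -/
theorem dynamic_programming_slabs
    (s S : ℝ) (hs : 0 ≤ s) (U : Set (ℝ × ℝ)) (hU : MeasurableSet U)
    (n : ℕ) (hn : 1 ≤ n) (x : ℕ → ℝ) (hx0 : x 0 = 0) (hxn : x n = S)
    (hmono : ∀ i, i < n → x i < x (i + 1)) (a b : ℝ) :
    slabCost s U 0 S a b =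
      sInf {c : ℝ≥0∞ | ∃ lam : ℕ → ℝ, lam 0 = a ∧ lam n = b ∧
        c = ∑ i ∈ Finset.range n, slabCost s U (x i) (x (i + 1)) (lam i) (lam (i + 1))} := by
  have hx : ∀ i, i < n → x i ≤ x (i + 1) := fun i hi => (hmono i hi).le
  rw [← hx0, ← hxn]
  apply le_antisymm
  · refine le_sInf ?_
    rintro _ ⟨lam, rfl, rfl, rfl⟩
    exact slabCost_le_sum s U hx lam
  · refine le_sInf ?_
    rintro _ ⟨γ, hγ, rfl, rfl, rfl⟩
    refine sInf_le_of_le ⟨fun i => γ (x i), rfl, rfl, rfl⟩ ?_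
    rw [← (sum_volume_sep_Icc hx fun t => (t, γ t) ∈ U).2]
    refine Finset.sum_le_sum fun i hi => slabCost_le (hγ.mono ?_ ?_) U
    all_goals have hi := Finset.mem_range.1 hi
    · exact monotoneOn_of_le_add_one ordConnected_Iic (fun j _ _ hj => hx j hj)
        (mem_Iic.2 n.zero_le) (mem_Iic.2 hi.le) i.zero_le
    · exact monotoneOn_of_le_add_one ordConnected_Iic (fun j _ _ hj => hx j hj)
        (mem_Iic.2 hi) (mem_Iic.2 le_rfl) hi
end
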